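/- Let k ≥ 3 and d ≥ 2 be integers. Then the rank over F₂ of M_k equals the number of integers a with 0 < a < 2^d−1 such that s(a) + s((k−1)a) = s*(ka), where s*(x) = s(x) if 2^d−1 does not divide x, and s*(x) = d if 2^d−1 divides x. -/

import Mathlib

/-- `sBin d x` is the number of 1's in the binary representation of the reduction of `x`
modulo `2^d - 1`. -/
def sBin (d x : ℕ) : ℕ := (Nat.digits 2 (x % (2 ^ d - 1))).count 1

/-- `sStar d x = sBin d x` if `2^d - 1 ∤ x`, and `= d` if `2^d - 1 ∣ x`. -/
def sStar (d x : ℕ) : ℕ := if (2 ^ d - 1) ∣ x then d else sBin d x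

/-- The rank of a (finite) square matrix over a commutative ring `K`. -/
noncomputable def matRank (K : Type*) [CommRing K] {ι : Type*} [Finite ι]
    (M : Matrix ι ι K) : ℕ :=
  letI : Fintype ι := Fintype.ofFinite ι
  M.rank

/-- The `(u,v)` entry of the circulant matrix `M_k`: the number of `x ∈ F_{2^d}ˣ` with
`v * u⁻¹ = x^k + x^{k-1}`. -/
noncomputable def Mmat (k d : ℕ) (u v : (GaloisField 2 d)ˣ) : ℕ :=
  Nat.card {x : (GaloisField 2 d)ˣ //
    (x : GaloisField 2 d) ^ k + (x : GaloisField 2 d) ^ (k - 1) =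
      ((v * u⁻¹ : (GaloisField 2 d)ˣ) : GaloisField 2 d)}

/-- Binary digit sum. -/
def pc (x : ℕ) : ℕ := (Nat.digits 2 x).sum

theorem pc_zero : pc 0 = 0 := by simp [pc]

theorem pc_bit (x e : ℕ) (he : e < 2) : pc (2 * x + e) = pc x + e := by
  unfold pc
  by_cases h : x = 0 ∧ e = 0
  · obtain ⟨rfl, rfl⟩ := h; simp
  · have := Nat.digits_add_two_add_one 0 (2 * x + e - 1)
    have h1 : 2 * x + e - 1 + 1 = 2 * x + e := by omega
    rw [h1] at this
    have h2 : (2 * x + e) % (0 + 2) = e := by omega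
    have h3 : (2 * x + e) / (0 + 2) = x := by omega
    rw [h2, h3] at this
    have h4 : (0 + 2 : ℕ) = 2 := rfl
    rw [h4] at this
    rw [this, List.sum_cons]; omega

theorem exists_bit (x : ℕ) : ∃ y e, e < 2 ∧ x = 2 * y + e :=
  ⟨x / 2, x % 2, by omega, by omega⟩

theorem pc_one : pc 1 = 1 := by simp [pc]

theorem pc_add_one_le (x : ℕ) : pc (x + 1) ≤ pc x + 1 := by
  induction x using Nat.strong_induction_on with
  | _ x ih =>
    obtain ⟨y, e, he, rfl⟩ := exists_bit x
    rw [pc_bit y e he]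
    interval_cases e
    · rw [Nat.add_zero, pc_bit y 1 (by omega)]
    · have h := ih y (by omega)
      have h2 := pc_bit (y + 1) 0 (by omega)
      have h3 : 2 * y + 1 + 1 = 2 * (y + 1) + 0 := by ring
      rw [h3, h2]; omega

theorem pc_add_le (x y : ℕ) : pc (x + y) ≤ pc x + pc y := by
  induction x using Nat.strong_induction_on generalizing y with
  | _ x ih =>
    by_cases hx : x = 0
    · subst hx; simp [pc_zero]
    obtain ⟨x', e, he, rfl⟩ := exists_bit x
    obtain ⟨y', f, hf, rfl⟩ := exists_bit y
    have h := ih x' (by omega) y'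
    rw [pc_bit x' e he, pc_bit y' f hf]
    by_cases hc : e + f < 2
    · have h3 : 2 * x' + e + (2 * y' + f) = 2 * (x' + y') + (e + f) := by ring
      rw [h3, pc_bit _ _ hc]; omega
    · have h3 : 2 * x' + e + (2 * y' + f) = 2 * (x' + y' + 1) + 0 := by omega
      have := pc_add_one_le (x' + y')
      rw [h3, pc_bit _ _ (by omega)]; omega

theorem pc_add_lt (d x y : ℕ) (hx : x < 2 ^ d) (hy : y < 2 ^ d) (hxy : 2 ^ d ≤ x + y) :
    pc (x + y) < pc x + pc y := by
  induction d generalizing x y with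
  | zero => omega
  | succ d ih =>
    obtain ⟨x', e, he, rfl⟩ := exists_bit x
    obtain ⟨y', f, hf, rfl⟩ := exists_bit y
    rw [pow_succ] at *
    rw [pc_bit x' e he, pc_bit y' f hf]
    by_cases hc : e + f < 2
    · have h := ih x' y' (by omega) (by omega) (by omega)
      have h3 : 2 * x' + e + (2 * y' + f) = 2 * (x' + y') + (e + f) := by ring
      rw [h3, pc_bit _ _ hc]; omega
    · have h3 : 2 * x' + e + (2 * y' + f) = 2 * (x' + y' + 1) + 0 := by omega
      have := pc_add_one_le (x' + y')
      have := pc_add_le x' y'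
      rw [h3, pc_bit _ _ (by omega)]; omega

theorem pc_compl (d x y : ℕ) (h : x + y + 1 = 2 ^ d) : pc x + pc y = d := by
  induction d generalizing x y with
  | zero =>
    have hx : x = 0 := by simp at h; omega
    have hy : y = 0 := by simp at h; omega
    subst hx; subst hy; simp [pc_zero]
  | succ d ih =>
    obtain ⟨x', e, he, rfl⟩ := exists_bit x
    obtain ⟨y', f, hf, rfl⟩ := exists_bit y
    rw [pow_succ] at h
    have h := ih x' y' (by omega)
    rw [pc_bit x' e he, pc_bit y' f hf]
    omega

theorem pc_add_pow (d x : ℕ) (h : x < 2 ^ d) : pc (x + 2 ^ d) = pc x + 1 := by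
  induction d generalizing x with
  | zero =>
    have hx : x = 0 := by simpa using h
    subst hx; simp [pc_zero, pc_one]
  | succ d ih =>
    obtain ⟨x', e, he, rfl⟩ := exists_bit x
    rw [pow_succ] at *
    have h := ih x' (by omega)
    have h3 : 2 * x' + e + 2 ^ d * 2 = 2 * (x' + 2 ^ d) + e := by ring
    rw [h3, pc_bit _ _ he, pc_bit _ _ he]; omega

theorem count_eq_sum (l : List ℕ) (h : ∀ x ∈ l, x < 2) : l.count 1 = l.sum := by
  induction l with
  | nil => simp
  | cons a l ih =>
    have h1 := ih (fun x hx => h x (by simp [hx]))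
    have h2 := h a (by simp)
    rw [List.count_cons, List.sum_cons, h1]
    interval_cases a <;> simp; omega

theorem sBin_eq (d x : ℕ) : sBin d x = pc (x % (2 ^ d - 1)) := by
  unfold sBin pc
  exact count_eq_sum _ fun x hx => Nat.digits_lt_base (by norm_num) hx

theorem choose_odd_iff (m b : ℕ) (h : b ≤ m) :
    ¬ (2 ∣ m.choose b) ↔ pc b + pc (m - b) = pc m := by
  have h1 := sub_one_mul_padicValNat_choose_eq_sub_sum_digits (p := 2) h
  have h2 : pc m ≤ pc b + pc (m - b) := by
    have := pc_add_le b (m - b)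
    rwa [Nat.add_sub_cancel' h] at this
  have h3 : m.choose b ≠ 0 := (Nat.choose_pos h).ne'
  have h4 := dvd_iff_padicValNat_ne_zero (p := 2) h3
  rw [h4]
  change _ = pc b + pc (m - b) - pc m at h1
  omega

/-- The key combinatorial equivalence. -/
theorem key_comb (k d a : ℕ) (hk : 3 ≤ k) (hd : 2 ≤ d) (ha : 0 < a) (han : a < 2 ^ d - 1) :
    (sBin d a + sBin d ((k - 1) * a) = sStar d (k * a)) ↔
      ¬ (2 ∣ (2 ^ d - 1 - a).choose ((k - 1) * a % (2 ^ d - 1))) := by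
  have hka : k * a = (k - 1) * a + a := by
    obtain ⟨k, rfl⟩ : ∃ j, k = j + 1 := ⟨k - 1, by omega⟩
    simp; ring
  unfold sStar
  have hdv : (2 ^ d - 1 ∣ k * a) ↔ ((k - 1) * a % (2 ^ d - 1) + a) % (2 ^ d - 1) = 0 := by
    rw [hka, Nat.dvd_iff_mod_eq_zero, Nat.add_mod, Nat.mod_eq_of_lt han]
  simp only [hdv]
  rw [sBin_eq, sBin_eq, sBin_eq, Nat.mod_eq_of_lt han, hka, Nat.add_mod ((k - 1) * a) a,
    Nat.mod_eq_of_lt han]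
  set n := 2 ^ d - 1 with hn
  have hb : (k - 1) * a % n < n := Nat.mod_lt _ (by omega)
  set b := (k - 1) * a % n with hbdef
  clear_value b
  have h2 : 1 ≤ 2 ^ d := Nat.one_le_two_pow
  have hca := pc_compl d a (n - a) (by omega)
  by_cases hle : b ≤ n - a
  · rw [choose_odd_iff _ _ hle]
    have hcb := pc_compl d (b + a) (n - a - b) (by omega)
    by_cases he : b + a = n
    · rw [he, Nat.mod_self, if_pos rfl]
      have hz : pc (n - a - b) = 0 := by
        rw [show n - a - b = 0 by omega, pc_zero]
      have hb' : pc (n - a) = pc b := by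
        rw [show n - a = b by omega]
      omega
    · rw [Nat.mod_eq_of_lt (by omega), if_neg (by omega)]
      omega
  · have hmod : (b + a) % n = b + a - n := by
      rw [Nat.mod_eq_sub_mod (by omega), Nat.mod_eq_of_lt (by omega)]
    rw [hmod, if_neg (by omega), Nat.choose_eq_zero_of_lt (by omega)]
    have h5 := pc_add_lt d b a (by omega) (by omega) (by omega)
    have h6 := pc_add_one_le (b + a)
    have h7 := pc_add_pow d (b + a - n) (by omega)
    have h8 : b + a - n + 2 ^ d = b + a + 1 := by omega
    rw [h8] at h7
    simp
    omega

/-- Rank is invariant under field extension. -/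
theorem rank_map_field {K L ι : Type*} [Field K] [Field L] [Fintype ι] (f : K →+* L)
    (M : Matrix ι ι K) : (M.map f).rank = M.rank := by
  classical
  obtain ⟨V, U, e, hV, hU, h⟩ := Matrix.exists_rank_normal_form M
  have hV' : V.det ≠ 0 := ((Matrix.isUnit_iff_isUnit_det _).1 hV).ne_zero
  have hU' : U.det ≠ 0 := ((Matrix.isUnit_iff_isUnit_det _).1 hU).ne_zero
  have hd : (Matrix.fromBlocks (1 : Matrix (Fin M.rank) (Fin M.rank) K) 0 0
      (0 : Matrix (Fin (Fintype.card ι - M.rank)) (Fin (Fintype.card ι - M.rank)) K)).submatrix e e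
      = Matrix.diagonal (fun i => if (e i).isLeft then (1 : K) else 0) := by
    ext i j
    rw [Matrix.submatrix_apply, Matrix.diagonal_apply]
    by_cases hij : i = j
    · subst hij
      rcases e i with x | x <;> simp
    · have : e i ≠ e j := fun h => hij (e.injective h)
      rw [if_neg hij]
      revert this
      rcases e i with x | x <;> rcases e j with y | y <;> simp [Matrix.one_apply]
  rw [hd] at h
  have h1 : M.rank = (V * M * U).rank := by
    rw [Matrix.rank_mul_eq_left_of_det_ne_zero _ _ hU',
      Matrix.rank_mul_eq_right_of_det_ne_zero _ _ hV']
  have h2 : (M.map f).rank = ((V * M * U).map f).rank := by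
    rw [Matrix.map_mul, Matrix.map_mul, Matrix.rank_mul_eq_left_of_det_ne_zero,
      Matrix.rank_mul_eq_right_of_det_ne_zero]
    · rw [← RingHom.mapMatrix_apply, ← RingHom.map_det]; simpa using hV'
    · rw [← RingHom.mapMatrix_apply, ← RingHom.map_det]; simpa using hU'
  rw [h1, h2, h, Matrix.diagonal_map (map_zero f), Matrix.rank_diagonal, Matrix.rank_diagonal]
  apply Fintype.card_congr
  apply Equiv.subtypeEquivRight
  intro i
  simp

/-- Rank of a circulant over the unit group of a finite field. -/
theorem rank_circ {F : Type*} [Field F] [Fintype F] [DecidableEq F] (n : ℕ)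
    (hn : Fintype.card Fˣ = n) (f : Fˣ → F) :
    (Matrix.of fun u v : Fˣ => f (v * u⁻¹)).rank =
      ((Finset.range n).filter (fun a => ∑ w : Fˣ, f w * ((w⁻¹ : Fˣ) : F) ^ a ≠ 0)).card := by
  classical
  let e : Fˣ ≃ Fin n := Fintype.equivFinOfCardEq hn
  let W : Matrix Fˣ Fˣ F := Matrix.of fun v g => ((v⁻¹ : Fˣ) : F) ^ (e g : ℕ)
  let l : Fˣ → F := fun g => ∑ w : Fˣ, f w * ((w⁻¹ : Fˣ) : F) ^ (e g : ℕ)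
  have hW : W.det ≠ 0 := by
    have : W = (Matrix.vandermonde (fun i : Fin n => (((e.symm i)⁻¹ : Fˣ) : F))).submatrix e e := by
      ext u v
      simp [W, Matrix.vandermonde]
    rw [this, Matrix.det_submatrix_equiv_self, Matrix.det_vandermonde_ne_zero_iff]
    intro i j h
    exact e.symm.injective (inv_injective (Units.ext h))
  have hMW : (Matrix.of fun u v : Fˣ => f (v * u⁻¹)) * W = W * Matrix.diagonal l := by
    ext u g
    rw [Matrix.mul_apply, Matrix.mul_diagonal]
    simp only [Matrix.of_apply, W, l]
    rw [Finset.mul_sum, ← Equiv.sum_comp (Equiv.mulRight u)]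
    apply Finset.sum_congr rfl
    intro w _
    simp [mul_pow]
    ring
  rw [← Matrix.rank_mul_eq_left_of_det_ne_zero _ _ hW, hMW,
    Matrix.rank_mul_eq_right_of_det_ne_zero _ _ hW, Matrix.rank_diagonal,
    Fintype.card_subtype]
  refine Finset.card_bij (fun g _ => (e g : ℕ)) ?_ ?_ ?_
  · intro g hg
    simpa [l] using hg
  · intro g _ g' _ h
    exact e.injective (Fin.ext h)
  · intro a ha
    rw [Finset.mem_filter, Finset.mem_range] at ha
    refine ⟨e.symm ⟨a, ha.1⟩, ?_, by simp⟩
    simpa [l] using ha.2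

theorem lam_eq {F : Type*} [Field F] [Fintype F] [DecidableEq F] (n k a : ℕ)
    (hF : Fintype.card F = n + 1) (hk : 3 ≤ k) (ha : a < n) :
    ∑ w : Fˣ, (Nat.card {x : Fˣ // (x : F) ^ k + (x : F) ^ (k - 1) = (w : F)} : F)
        * ((w⁻¹ : Fˣ) : F) ^ a =
    - ∑ j ∈ Finset.range (n - a + 1),
      (if n ∣ (k - 1) * (n - a) + j then ((n - a).choose j : F) else 0) := by
  classical
  have hG : ∀ w : Fˣ, ((w⁻¹ : Fˣ) : F) ^ a = (w : F) ^ (n - a) := by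
    intro w
    have h1 : w ^ n = 1 := by
      rw [← pow_card_eq_one (x := w), Fintype.card_units, hF]; simp
    have h2 : (w⁻¹) ^ a = w ^ (n - a) := by
      rw [inv_pow, inv_eq_iff_mul_eq_one, ← pow_add, Nat.add_sub_cancel' ha.le, h1]
    exact_mod_cast congrArg (Units.val) h2
  have h1 : ∀ w : Fˣ, (Nat.card {x : Fˣ // (x : F) ^ k + (x : F) ^ (k - 1) = (w : F)} : F)
        * ((w⁻¹ : Fˣ) : F) ^ a =
      ∑ x : Fˣ, if (x : F) ^ k + (x : F) ^ (k - 1) = (w : F) then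
        ((x : F) ^ k + (x : F) ^ (k - 1)) ^ (n - a) else 0 := by
    intro w
    rw [hG, Nat.card_eq_fintype_card, Fintype.card_subtype, ← Finset.sum_filter,
      ← nsmul_eq_mul, ← Finset.sum_const]
    apply Finset.sum_congr rfl
    intro x hx
    rw [(Finset.mem_filter.1 hx).2]
  rw [Finset.sum_congr rfl (fun w _ => h1 w), Finset.sum_comm]
  have h2 : ∀ x : Fˣ, (∑ w : Fˣ, if (x : F) ^ k + (x : F) ^ (k - 1) = (w : F) then
        ((x : F) ^ k + (x : F) ^ (k - 1)) ^ (n - a) else 0) =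
      ∑ j ∈ Finset.range (n - a + 1), (x : F) ^ ((k - 1) * (n - a) + j) * ((n - a).choose j : F) := by
    intro x
    have h3 : ((x : F) ^ k + (x : F) ^ (k - 1)) ^ (n - a) =
        ∑ j ∈ Finset.range (n - a + 1),
          (x : F) ^ ((k - 1) * (n - a) + j) * ((n - a).choose j : F) := by
      have : (x : F) ^ k + (x : F) ^ (k - 1) = (x : F) ^ (k - 1) * ((x : F) + 1) := by
        conv_lhs => rw [show k = (k - 1) + 1 by omega]
        rw [pow_succ, Nat.add_sub_cancel]; ring
      rw [this, mul_pow, add_pow, Finset.mul_sum]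
      apply Finset.sum_congr rfl
      intro j _
      rw [pow_add, pow_mul]; simp; ring
    rw [← h3]
    by_cases h0 : (x : F) ^ k + (x : F) ^ (k - 1) = 0
    · rw [h0, zero_pow (by omega)]; simp
    · rw [Finset.sum_eq_single (Units.mk0 _ h0)]
      · simp
      · intro w _ hw
        rw [if_neg]
        intro h
        exact hw (Units.ext (by simp [h]))
      · simp
  rw [Finset.sum_congr rfl (fun x _ => h2 x), Finset.sum_comm, ← Finset.sum_neg_distrib]
  apply Finset.sum_congr rfl
  intro j _
  rw [← Finset.sum_mul, FiniteField.sum_pow_units, hF, Nat.add_sub_cancel]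
  split_ifs <;> simp

theorem lam_zero {F : Type*} [Field F] [CharP F 2] (n k : ℕ) (hn : 0 < n) :
    ∑ j ∈ Finset.range (n - 0 + 1),
      (if n ∣ (k - 1) * (n - 0) + j then ((n - 0).choose j : F) else 0) = 0 := by
  simp only [Nat.sub_zero]
  rw [Finset.sum_range_succ]
  obtain ⟨m, rfl⟩ : ∃ m, n = m + 1 := ⟨n - 1, by omega⟩
  rw [Finset.sum_range_succ']
  rw [Finset.sum_eq_zero]
  · rw [if_pos (by simp), if_pos]
    · simp [CharTwo.add_self_eq_zero]
    · exact dvd_add (dvd_mul_left _ _) dvd_rfl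
  · intro j hj
    rw [if_neg]
    intro h
    have h' := (Nat.dvd_add_right (dvd_mul_left (m + 1) (k - 1))).1 h
    have := Nat.le_of_dvd (by omega) h'
    have := Finset.mem_range.1 hj
    omega

theorem lam_pos {F : Type*} [Field F] (n k a : ℕ) (ha : 0 < a) (han : a < n) :
    ∑ j ∈ Finset.range (n - a + 1),
      (if n ∣ (k - 1) * (n - a) + j then ((n - a).choose j : F) else 0) =
      ((n - a).choose ((k - 1) * a % n) : F) := by
  have h : ∀ j ∈ Finset.range (n - a + 1),
      (if n ∣ (k - 1) * (n - a) + j then ((n - a).choose j : F) else 0) =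
      (if j = (k - 1) * a % n then ((n - a).choose j : F) else 0) := by
    intro j hj
    have hj' := Finset.mem_range.1 hj
    have : n ∣ (k - 1) * (n - a) + j ↔ j = (k - 1) * a % n := by
      have e1 : (k - 1) * (n - a) + (k - 1) * a = (k - 1) * n := by
        rw [← mul_add, Nat.sub_add_cancel han.le]
      have e2 : n ∣ (k - 1) * (n - a) + j ↔ j ≡ (k - 1) * a [MOD n] := by
        rw [← Nat.modEq_zero_iff_dvd]
        have e3 : (k - 1) * (n - a) + (k - 1) * a ≡ 0 [MOD n] := by
          rw [e1]; exact Nat.modEq_zero_iff_dvd.2 (dvd_mul_left _ _)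
        constructor
        · intro h; exact Nat.ModEq.add_left_cancel' _ (h.trans e3.symm)
        · intro h; exact (Nat.ModEq.add_left _ h).trans e3
      rw [e2, Nat.ModEq, Nat.mod_eq_of_lt (show j < n by omega)]
    simp only [this]
  rw [Finset.sum_congr rfl h, Finset.sum_ite_eq']
  split_ifs with h1
  · rfl
  · rw [Finset.mem_range] at h1
    rw [Nat.choose_eq_zero_of_lt (by omega)]; simp

/-- For `k ≥ 3` and `d ≥ 2`, the rank of `M_k` over `F₂` equals the number of `a` with
`0 < a < 2^d - 1` such that `s(a) + s((k-1)a) = s*(ka)`. -/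
theorem stmt_19 (k d : ℕ) (hk : 3 ≤ k) (hd : 2 ≤ d) :
    matRank (ZMod 2)
      (Matrix.of fun u v : (GaloisField 2 d)ˣ => (Mmat k d u v : ZMod 2)) =
    ((Finset.Ioo 0 (2 ^ d - 1)).filter
      (fun a => sBin d a + sBin d ((k - 1) * a) = sStar d (k * a))).card := by
  classical
  unfold matRank
  letI : Fintype (GaloisField 2 d) := Fintype.ofFinite _
  have h4 : 2 ^ 2 ≤ 2 ^ d := Nat.pow_le_pow_right (by norm_num) hd
  have hF : Fintype.card (GaloisField 2 d) = (2 ^ d - 1) + 1 := by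
    rw [← Nat.card_eq_fintype_card, GaloisField.card 2 d (by omega)]; omega
  have hcu : Fintype.card (GaloisField 2 d)ˣ = 2 ^ d - 1 := by
    rw [Fintype.card_units, hF]; simp
  rw [Subsingleton.elim (Fintype.ofFinite (GaloisField 2 d)ˣ) instFintypeUnitsOfDecidableEq,
    ← rank_map_field (algebraMap (ZMod 2) (GaloisField 2 d))]
  have hm : (Matrix.of fun u v : (GaloisField 2 d)ˣ => (Mmat k d u v : ZMod 2)).map
      (algebraMap (ZMod 2) (GaloisField 2 d)) =
      Matrix.of fun u v : (GaloisField 2 d)ˣ =>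
        (fun w : (GaloisField 2 d)ˣ => (Nat.card {x : (GaloisField 2 d)ˣ //
          (x : GaloisField 2 d) ^ k + (x : GaloisField 2 d) ^ (k - 1) =
          (w : GaloisField 2 d)} : GaloisField 2 d)) (v * u⁻¹) := by
    ext u v
    simp [Mmat]
  rw [hm]
  have hr := rank_circ (2 ^ d - 1) hcu (fun w : (GaloisField 2 d)ˣ =>
        (Nat.card {x : (GaloisField 2 d)ˣ //
          (x : GaloisField 2 d) ^ k + (x : GaloisField 2 d) ^ (k - 1) =
          (w : GaloisField 2 d)} : GaloisField 2 d))
  have hset : ((Finset.range (2 ^ d - 1)).filter (fun a => ∑ w : (GaloisField 2 d)ˣ,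
      (Nat.card {x : (GaloisField 2 d)ˣ //
          (x : GaloisField 2 d) ^ k + (x : GaloisField 2 d) ^ (k - 1) =
          (w : GaloisField 2 d)} : GaloisField 2 d) *
        ((w⁻¹ : (GaloisField 2 d)ˣ) : GaloisField 2 d) ^ a ≠ 0)) =
      ((Finset.Ioo 0 (2 ^ d - 1)).filter
      (fun a => sBin d a + sBin d ((k - 1) * a) = sStar d (k * a))) := by
    ext a
    rw [Finset.mem_filter, Finset.mem_filter, Finset.mem_range, Finset.mem_Ioo]
    by_cases han : a < 2 ^ d - 1
    · rw [lam_eq (2 ^ d - 1) k a hF hk han]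
      by_cases ha : 0 < a
      · rw [lam_pos _ _ _ ha han, key_comb k d a hk hd ha han, neg_ne_zero, ne_eq,
          CharP.cast_eq_zero_iff (GaloisField 2 d) 2]
        simp [ha]
      · have : a = 0 := by omega
        subst this
        rw [lam_zero _ _ (by omega)]
        simp
    · simp [han]
  rw [← hset]
  convert hr
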